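/- arXiv:1301.3916 — 3 statements merged into one kernel-verified Lean document; each statement's English description precedes it below -/
import Mathlib

section
/- For real α > −1/2 and all z, Σ_{k≥0} (z/2)^{2k+α}/(k! Γ(k+α+1)) = ((z/2)^α / (√π Γ(α + 1/2))) ∫_0^π e^{z cos θ} (sin θ)^{2α} dθ. -/
open MeasureTheory Set

/-- The Beta integrand with positive real parameters is integrable on the unit interval. -/
theorem integrableOn_rpow_mul_one_sub_rpow {a b : ℝ} (ha : 0 < a) (hb : 0 < b) :
    IntegrableOn (fun x : ℝ ↦ x ^ (a - 1) * (1 - x) ^ (b - 1)) (Ioo 0 1) := by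
  have h := Complex.betaIntegral_convergent (u := a) (v := b) (by simpa) (by simpa)
  rw [intervalIntegrable_iff_integrableOn_Ioo_of_le zero_le_one] at h
  refine IntegrableOn.congr_fun h.re (fun x hx ↦ ?_) measurableSet_Ioo
  have h1 : (0 : ℝ) ≤ 1 - x := by linarith [hx.2]
  change ((x : ℂ) ^ ((a : ℂ) - 1) * (1 - (x : ℂ)) ^ ((b : ℂ) - 1)).re = _
  rw [← Complex.ofReal_re (x ^ (a - 1) * (1 - x) ^ (b - 1))]
  push_cast [Complex.ofReal_cpow hx.1.le, Complex.ofReal_cpow h1]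
  rfl

/-- The real Beta integral in terms of the Gamma function. -/
theorem setIntegral_rpow_mul_one_sub_rpow {a b : ℝ} (ha : 0 < a) (hb : 0 < b) :
    ∫ x in Ioo (0 : ℝ) 1, x ^ (a - 1) * (1 - x) ^ (b - 1) = ProbabilityTheory.beta a b := by
  have h : ((∫ x in Ioo (0 : ℝ) 1, x ^ (a - 1) * (1 - x) ^ (b - 1) : ℝ) : ℂ)
      = Complex.betaIntegral a b := by
    rw [Complex.betaIntegral, intervalIntegral.integral_of_le zero_le_one,
      integral_Ioc_eq_integral_Ioo, ← integral_complex_ofReal]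
    refine setIntegral_congr_fun measurableSet_Ioo fun x hx ↦ ?_
    have h1 : (0 : ℝ) ≤ 1 - x := by linarith [hx.2]
    push_cast [Complex.ofReal_cpow hx.1.le, Complex.ofReal_cpow h1]
    rfl
  rw [ProbabilityTheory.beta_eq_betaIntegralReal a b ha hb, ← h, Complex.ofReal_re]

theorem strictAntiOn_cos_sq : StrictAntiOn (fun θ : ℝ ↦ Real.cos θ ^ 2) (Icc 0 (Real.pi / 2)) := by
  intro x hx y hy hxy
  have h1 := Real.strictAntiOn_cos ⟨hx.1, by linarith [hx.2, Real.pi_pos]⟩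
    ⟨hy.1, by linarith [hy.2, Real.pi_pos]⟩ hxy
  have h2 : 0 ≤ Real.cos y := Real.cos_nonneg_of_mem_Icc ⟨by linarith [hy.1, Real.pi_pos], hy.2⟩
  exact pow_lt_pow_left₀ h1 h2 two_ne_zero

theorem image_cos_sq_Ioo :
    (fun θ : ℝ ↦ Real.cos θ ^ 2) '' Ioo 0 (Real.pi / 2) = Ioo 0 1 := by
  have hp : (0 : ℝ) ≤ Real.pi / 2 := by positivity
  apply Subset.antisymm
  · rintro _ ⟨θ, hθ, rfl⟩
    have h1 := strictAntiOn_cos_sq (left_mem_Icc.2 hp) (Ioo_subset_Icc_self hθ) hθ.1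
    have h2 := strictAntiOn_cos_sq (Ioo_subset_Icc_self hθ) (right_mem_Icc.2 hp) hθ.2
    simp only [Real.cos_zero, Real.cos_pi_div_two] at h1 h2
    exact ⟨by simpa using h2, by simpa using h1⟩
  · have h := intermediate_value_Ioo' hp
      (f := fun θ : ℝ ↦ Real.cos θ ^ 2) (by fun_prop)
    simpa using h

/-- The Jacobian of `θ ↦ cos θ ^ 2` turns the Beta integrand into a product of powers of
`cos` and `sin`. -/
theorem abs_deriv_cos_sq_smul_beta_integrand (k : ℕ) (α : ℝ) {θ : ℝ}
    (hθ : θ ∈ Ioo 0 (Real.pi / 2)) :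
    |2 * Real.cos θ * -Real.sin θ| • ((Real.cos θ ^ 2) ^ ((k + 1 / 2 : ℝ) - 1) *
        (1 - Real.cos θ ^ 2) ^ ((α + 1 / 2) - 1))
      = 2 * (Real.cos θ ^ (2 * k) * Real.sin θ ^ (2 * α)) := by
  have hc : 0 < Real.cos θ :=
    Real.cos_pos_of_mem_Ioo ⟨by linarith [hθ.1, Real.pi_pos], hθ.2⟩
  have hs : 0 < Real.sin θ := Real.sin_pos_of_pos_of_lt_pi hθ.1 (by linarith [hθ.2, Real.pi_pos])
  have e1 : 1 - Real.cos θ ^ 2 = Real.sin θ ^ 2 := by rw [← Real.sin_sq_add_cos_sq θ]; ring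
  have e2 : |2 * Real.cos θ * -Real.sin θ| = 2 * Real.cos θ * Real.sin θ := by
    rw [mul_neg, abs_neg, abs_of_pos (by positivity)]
  have e3 : (Real.cos θ ^ 2) ^ ((k + 1 / 2 : ℝ) - 1) = Real.cos θ ^ (2 * k) / Real.cos θ := by
    rw [← Real.rpow_natCast_mul hc.le, ← Real.rpow_natCast, ← Real.rpow_sub_one hc.ne']
    congr 1; push_cast; ring
  have e4 : (Real.sin θ ^ 2) ^ ((α + 1 / 2 : ℝ) - 1) = Real.sin θ ^ (2 * α) / Real.sin θ := by
    rw [← Real.rpow_natCast_mul hs.le, ← Real.rpow_sub_one hs.ne']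
    congr 1; push_cast; ring
  rw [e1, e2, e3, e4, smul_eq_mul]
  field_simp

theorem hasDerivWithinAt_cos_sq (θ : ℝ) (s : Set ℝ) :
    HasDerivWithinAt (fun θ : ℝ ↦ Real.cos θ ^ 2) (2 * Real.cos θ * -Real.sin θ) s θ := by
  have h := ((Real.hasDerivAt_cos θ).fun_pow 2).hasDerivWithinAt (s := s)
  norm_num at h ⊢
  exact h

theorem injOn_cos_sq_Ioo : InjOn (fun θ : ℝ ↦ Real.cos θ ^ 2) (Ioo 0 (Real.pi / 2)) :=
  strictAntiOn_cos_sq.injOn.mono Ioo_subset_Icc_self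

theorem intervalIntegrable_cos_pow_mul_sin_rpow_half {α : ℝ} (hα : -(1 / 2) < α) (k : ℕ) :
    IntervalIntegrable (fun θ ↦ Real.cos θ ^ (2 * k) * Real.sin θ ^ (2 * α)) volume
      0 (Real.pi / 2) := by
  rw [intervalIntegrable_iff_integrableOn_Ioo_of_le (by positivity)]
  have h := integrableOn_rpow_mul_one_sub_rpow (a := k + 1 / 2) (b := α + 1 / 2)
    (by positivity) (by linarith)
  rw [← image_cos_sq_Ioo, integrableOn_image_iff_integrableOn_abs_deriv_smul measurableSet_Ioo
    (fun θ _ ↦ hasDerivWithinAt_cos_sq θ _) injOn_cos_sq_Ioo] at h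
  have h2 := IntegrableOn.congr_fun h
    (fun θ hθ ↦ abs_deriv_cos_sq_smul_beta_integrand k α hθ) measurableSet_Ioo
  simpa [IntegrableOn] using h2.const_mul (1 / 2)

theorem integral_cos_pow_mul_sin_rpow_half {α : ℝ} (hα : -(1 / 2) < α) (k : ℕ) :
    2 * ∫ θ in (0 : ℝ)..(Real.pi / 2), Real.cos θ ^ (2 * k) * Real.sin θ ^ (2 * α)
      = ProbabilityTheory.beta (k + 1 / 2) (α + 1 / 2) := by
  rw [← setIntegral_rpow_mul_one_sub_rpow (by positivity) (by linarith), ← image_cos_sq_Ioo,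
    integral_image_eq_integral_abs_deriv_smul measurableSet_Ioo
      (fun θ _ ↦ hasDerivWithinAt_cos_sq θ _) injOn_cos_sq_Ioo,
    setIntegral_congr_fun measurableSet_Ioo
      (fun θ hθ ↦ abs_deriv_cos_sq_smul_beta_integrand k α hθ),
    integral_const_mul, intervalIntegral.integral_of_le (by positivity),
    integral_Ioc_eq_integral_Ioo]

theorem intervalIntegrable_sin_rpow {α : ℝ} (hα : -(1 / 2) < α) :
    IntervalIntegrable (fun θ ↦ Real.sin θ ^ (2 * α)) volume 0 Real.pi := by
  have h : IntervalIntegrable (fun θ ↦ Real.sin θ ^ (2 * α)) volume 0 (Real.pi / 2) := by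
    simpa using intervalIntegrable_cos_pow_mul_sin_rpow_half hα 0
  have h' := (h.comp_sub_left Real.pi).symm
  simp only [Real.sin_pi_sub, sub_zero, sub_half] at h'
  exact h.trans h'

theorem intervalIntegrable_cos_pow_mul_sin_rpow {α : ℝ} (hα : -(1 / 2) < α) (n : ℕ) :
    IntervalIntegrable (fun θ ↦ Real.cos θ ^ n * Real.sin θ ^ (2 * α)) volume 0 Real.pi :=
  (intervalIntegrable_sin_rpow hα).continuousOn_mul (by fun_prop)

theorem integral_cos_pow_mul_sin_rpow_of_odd (α : ℝ) {n : ℕ} (hn : Odd n) :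
    ∫ θ in (0 : ℝ)..Real.pi, Real.cos θ ^ n * Real.sin θ ^ (2 * α) = 0 := by
  have h := intervalIntegral.integral_comp_sub_left (a := 0) (b := Real.pi)
    (fun θ ↦ Real.cos θ ^ n * Real.sin θ ^ (2 * α)) Real.pi
  simp only [Real.sin_pi_sub, Real.cos_pi_sub, hn.neg_pow, neg_mul,
    intervalIntegral.integral_neg, sub_self, sub_zero] at h
  linarith

theorem integral_cos_pow_even_mul_sin_rpow {α : ℝ} (hα : -(1 / 2) < α) (k : ℕ) :
    ∫ θ in (0 : ℝ)..Real.pi, Real.cos θ ^ (2 * k) * Real.sin θ ^ (2 * α)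
      = ProbabilityTheory.beta (k + 1 / 2) (α + 1 / 2) := by
  have hi := intervalIntegrable_cos_pow_mul_sin_rpow hα (2 * k)
  have hp := Real.pi_pos
  have h := intervalIntegral.integral_comp_sub_left (a := 0) (b := Real.pi / 2)
    (fun θ ↦ Real.cos θ ^ (2 * k) * Real.sin θ ^ (2 * α)) Real.pi
  simp only [Real.sin_pi_sub, Real.cos_pi_sub, (even_two_mul k).neg_pow, sub_zero,
    sub_half] at h
  rw [← integral_cos_pow_mul_sin_rpow_half hα,
    ← intervalIntegral.integral_add_adjacent_intervals (b := Real.pi / 2), ← h]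
  · ring
  · exact intervalIntegrable_cos_pow_mul_sin_rpow_half hα k
  · refine hi.mono_set ?_
    rw [uIcc_of_le (by linarith), uIcc_of_le hp.le]
    exact Icc_subset_Icc_left (by linarith)

theorem hasSum_integral_exp_mul_cos_mul_sin_rpow {α : ℝ} (hα : -(1 / 2) < α) (z : ℝ) :
    HasSum (fun n : ℕ ↦ z ^ n / n.factorial *
        ∫ θ in (0 : ℝ)..Real.pi, Real.cos θ ^ n * Real.sin θ ^ (2 * α))
      (∫ θ in (0 : ℝ)..Real.pi, Real.exp (z * Real.cos θ) * Real.sin θ ^ (2 * α)) := by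
  simp_rw [← intervalIntegral.integral_const_mul]
  have hsin : ∀ θ ∈ uIoc 0 Real.pi, 0 ≤ Real.sin θ := fun θ hθ ↦ by
    rw [uIoc_of_le Real.pi_pos.le] at hθ
    exact Real.sin_nonneg_of_nonneg_of_le_pi hθ.1.le hθ.2
  have hexp : ∀ x : ℝ, HasSum (fun n : ℕ ↦ x ^ n / n.factorial) (Real.exp x) := fun x ↦ by
    rw [Real.exp_eq_exp_ℝ]
    exact NormedSpace.expSeries_div_hasSum_exp x
  refine intervalIntegral.hasSum_integral_of_dominated_convergence
    (fun n θ ↦ |z| ^ n / n.factorial * Real.sin θ ^ (2 * α)) (fun n ↦ ?_) (fun n ↦ ?_) ?_ ?_ ?_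
  · exact ((intervalIntegrable_cos_pow_mul_sin_rpow hα n).const_mul _).def'.aestronglyMeasurable
  · refine .of_forall fun θ hθ ↦ ?_
    rw [norm_mul, norm_mul, norm_div, norm_pow, norm_pow, Real.norm_natCast,
      Real.norm_of_nonneg (Real.rpow_nonneg (hsin θ hθ) _)]
    refine mul_le_mul_of_nonneg_left ?_ (by positivity)
    exact mul_le_of_le_one_left (Real.rpow_nonneg (hsin θ hθ) _)
        (pow_le_one₀ (norm_nonneg _) (Real.abs_cos_le_one θ))
  · exact .of_forall fun θ _ ↦ (hexp |z|).summable.mul_right _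
  · simp_rw [tsum_mul_right]
    exact (intervalIntegrable_sin_rpow hα).const_mul _
  · refine .of_forall fun θ _ ↦ ?_
    refine ((hexp (z * Real.cos θ)).mul_right (Real.sin θ ^ (2 * α))).congr_fun fun n ↦ ?_
    rw [mul_pow]
    ring

theorem Gamma_nat_add_half_mul_factorial (k : ℕ) :
    Real.Gamma (k + 1 / 2) * k.factorial * 2 ^ (2 * k) = (2 * k).factorial * √Real.pi := by
  have h := Real.Gamma_mul_Gamma_add_half (k + 1 / 2)
  have e1 : (k + 1 / 2 + 1 / 2 : ℝ) = k + 1 := by ring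
  have e2 : (2 * (k + 1 / 2) : ℝ) = (2 * k : ℕ) + 1 := by push_cast; ring
  have e3 : (1 - ((2 * k : ℕ) + 1) : ℝ) = -((2 * k : ℕ) : ℝ) := by ring
  rw [e1, e2, e3, Real.Gamma_nat_eq_factorial, Real.Gamma_nat_eq_factorial,
    Real.rpow_neg zero_le_two, Real.rpow_natCast] at h
  rw [h]
  field_simp

theorem besselI_integral_rep (α : ℝ) (hα : -(1/2) < α) (z : ℝ) (hz : 0 < z) :
    (∑' k : ℕ, (z / 2) ^ ((2 * k : ℝ) + α) / ((k.factorial : ℝ) * Real.Gamma (k + α + 1)))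
      = ((z / 2) ^ α / (Real.sqrt Real.pi * Real.Gamma (α + 1/2))) *
        ∫ θ in (0:ℝ)..Real.pi, Real.exp (z * Real.cos θ) * (Real.sin θ) ^ (2 * α) := by
  have hinj : Function.Injective fun k : ℕ ↦ 2 * k := fun a b h ↦ by simpa using h
  have h := (hinj.hasSum_iff fun n hn ↦ ?_).2 (hasSum_integral_exp_mul_cos_mul_sin_rpow hα z)
  · rw [← (h.mul_left _).tsum_eq]
    refine tsum_congr fun k ↦ ?_
    have hG : 0 < Real.Gamma (α + 1 / 2) := Real.Gamma_pos_of_pos (by linarith)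
    have hG' : 0 < Real.Gamma (k + α + 1) :=
      Real.Gamma_pos_of_pos (by linarith [k.cast_nonneg (α := ℝ)])
    have hpi : 0 < √Real.pi := Real.sqrt_pos.2 Real.pi_pos
    have hd := Gamma_nat_add_half_mul_factorial k
    have e : (z / 2) ^ ((2 * k : ℝ) + α) = z ^ (2 * k) / 2 ^ (2 * k) * (z / 2) ^ α := by
      rw [Real.rpow_add (by positivity), ← div_pow, ← Real.rpow_natCast]
      push_cast
      rfl
    have e' : (k + 1 / 2 + (α + 1 / 2) : ℝ) = k + α + 1 := by ring
    simp only [Function.comp_apply]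
    rw [integral_cos_pow_even_mul_sin_rpow hα, ProbabilityTheory.beta, e, e']
    generalize Real.Gamma (k + 1 / 2) = g at hd ⊢
    have hg : g = (2 * k).factorial * √Real.pi / (k.factorial * 2 ^ (2 * k)) := by
      rw [← hd]; field_simp
    rw [hg]
    generalize Real.Gamma (α + 1 / 2) = c at hG ⊢
    field_simp
  · have hodd : Odd n := by
      rw [← Nat.not_even_iff_odd]
      rintro ⟨k, rfl⟩
      exact hn ⟨k, two_mul k⟩
    rw [integral_cos_pow_mul_sin_rpow_of_odd α hodd, mul_zero]
end

section
/- For 0 ≤ z < 1 and d ≥ 1, the generating function Q(z) = Σ_{n≥0} q_n z^n of the return probabilities of the simple random walk on Z^d admits the integral representation Q(z) = ∫_0^∞ I_0(tz/d)^d e^{−t} dt. -/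
open MeasureTheory

/-- Loops of length `n` at the origin in `ℤ^d`: walks with unit lattice steps. -/
def loopZd (d n : ℕ) : Set (Fin (n+1) → Fin d → ℤ) :=
  {w | w 0 = 0 ∧ w (Fin.last n) = 0 ∧
    ∀ i : Fin n, (∑ j, |w i.succ j - w i.castSucc j|) = 1}

/-- `q n`: probability the simple random walk on `ℤ^d` is back at its start at time `n`. -/
noncomputable def returnProb (d n : ℕ) : ℝ := ((loopZd d n).ncard : ℝ) / (2 * d) ^ n

/-- The modified Bessel function of the first kind of order 0. -/
noncomputable def besselI0 (z : ℝ) : ℝ := ∑' k : ℕ, (z / 2) ^ (2 * k) / (k.factorial : ℝ) ^ 2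

/-- Walks of length `n` with unit lattice steps in `ℤ^d` from the origin to `v`. -/
def walksZd (d n : ℕ) (v : Fin d → ℤ) : Set (Fin (n + 1) → Fin d → ℤ) :=
  {w | w 0 = 0 ∧ w (Fin.last n) = v ∧
    ∀ i : Fin n, (∑ j, |w i.succ j - w i.castSucc j|) = 1}

/-- The unit lattice steps in `ℤ^d`, indexed by a direction and a sign. -/
def latticeStep {d : ℕ} (s : Fin d × Bool) : Fin d → ℤ :=
  Pi.single s.1 (if s.2 then 1 else -1)

lemma latticeStep_injective {d : ℕ} : Function.Injective (latticeStep (d := d)) := by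
  rintro ⟨i, a⟩ ⟨j, b⟩ h
  have hi := congrFun h i
  by_cases hij : i = j
  · subst hij
    cases a <;> cases b <;> simp_all [latticeStep]
  · cases a <;> simp [latticeStep, Pi.single_eq_of_ne hij] at hi

lemma sum_abs_eq_one_iff {d : ℕ} (u : Fin d → ℤ) :
    (∑ j, |u j|) = 1 ↔ ∃ s, u = latticeStep s := by
  constructor
  · intro h
    obtain ⟨i, hi⟩ : ∃ i, u i ≠ 0 := by
      by_contra! h0
      simp [h0] at h
    have hsplit := Finset.add_sum_erase Finset.univ (fun j => |u j|) (Finset.mem_univ i)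
    have hnonneg : 0 ≤ ∑ j ∈ Finset.univ.erase i, |u j| :=
      Finset.sum_nonneg fun j _ => abs_nonneg _
    have hpos : 0 < |u i| := abs_pos.mpr hi
    simp only [h] at hsplit
    have hone : |u i| = 1 := by lia
    have hrest : ∑ j ∈ Finset.univ.erase i, |u j| = 0 := by lia
    rw [Finset.sum_eq_zero_iff_of_nonneg fun j _ => abs_nonneg _] at hrest
    have hu : u = Pi.single i (u i) := by
      ext j
      by_cases hj : j = i
      · subst hj; simp
      · rw [Pi.single_eq_of_ne hj]
        simpa using hrest j (by simp [hj])
    rcases (abs_eq (zero_le_one (α := ℤ))).mp hone with h1 | h1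
    · exact ⟨(i, true), by rw [hu]; simp [latticeStep, h1]⟩
    · exact ⟨(i, false), by rw [hu]; simp [latticeStep, h1]⟩
  · rintro ⟨⟨i, b⟩, rfl⟩
    rw [Finset.sum_eq_single i (fun j _ hj => by simp [latticeStep, hj]) (by simp)]
    cases b <;> simp [latticeStep]

lemma walksZd_succ (d n : ℕ) (v : Fin d → ℤ) :
    walksZd d (n + 1) v =
      ⋃ s, (fun w => Fin.snoc (α := fun _ => Fin d → ℤ) w v) ''
        walksZd d n (v - latticeStep s) := by
  ext w
  simp only [Set.mem_iUnion, Set.mem_image]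
  constructor
  · rintro ⟨h0, hl, hs⟩
    obtain ⟨s, hstep⟩ := (sum_abs_eq_one_iff (fun j => w (Fin.last n).succ j -
      w (Fin.last n).castSucc j)).mp (hs (Fin.last n))
    refine ⟨s, Fin.init w, ⟨h0, ?_, fun i => ?_⟩, ?_⟩
    · rw [← hstep, ← hl]
      ext j
      simp [Fin.init]
    · simpa [Fin.init] using hs i.castSucc
    · rw [← hl]
      exact Fin.snoc_init_self w
  · rintro ⟨s, w, ⟨h0, hl, hs⟩, rfl⟩
    refine ⟨?_, by simp, fun i => ?_⟩
    · rw [← Fin.castSucc_zero, Fin.snoc_castSucc, h0]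
    · induction i using Fin.lastCases with
      | last =>
        rw [Fin.succ_last, Fin.snoc_last, Fin.snoc_castSucc, hl]
        exact (sum_abs_eq_one_iff _).mpr ⟨s, by ext; simp⟩
      | cast i =>
        rw [Fin.succ_castSucc, Fin.snoc_castSucc, Fin.snoc_castSucc]
        exact hs i

lemma snoc_left_injective {d n : ℕ} (v : Fin d → ℤ) :
    Function.Injective fun w : Fin n → Fin d → ℤ =>
      Fin.snoc (α := fun _ => Fin d → ℤ) w v := by
  intro w w' h
  simpa using congrArg (Fin.init (α := fun _ => Fin d → ℤ)) h

lemma walksZd_zero (d : ℕ) (v : Fin d → ℤ) :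
    walksZd d 0 v = if v = 0 then {0} else ∅ := by
  ext w
  have hw : w = 0 ↔ w 0 = 0 :=
    ⟨fun h => by simp [h], fun h => funext fun i => by rw [Fin.fin_one_eq_zero i, h]; rfl⟩
  split_ifs with hv
  · simp [walksZd, hv, hw]
  · simp only [walksZd, Set.mem_ofPred_eq, Set.mem_empty_iff_false, iff_false]
    rintro ⟨h0, hl, -⟩
    exact hv (hl.symm.trans h0)

lemma walksZd_finite (d n : ℕ) (v : Fin d → ℤ) : (walksZd d n v).Finite := by
  induction n generalizing v with
  | zero => rw [walksZd_zero]; split_ifs <;> simp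
  | succ n ih =>
    rw [walksZd_succ]
    exact Set.finite_iUnion fun s => (ih _).image _

lemma ncard_walksZd_zero (d : ℕ) (v : Fin d → ℤ) :
    (walksZd d 0 v).ncard = if v = 0 then 1 else 0 := by
  rw [walksZd_zero]; split_ifs <;> simp

lemma ncard_walksZd_succ (d n : ℕ) (v : Fin d → ℤ) :
    (walksZd d (n + 1) v).ncard =
      ∑ j, ((walksZd d n (v - Pi.single j 1)).ncard +
        (walksZd d n (v + Pi.single j 1)).ncard) := by
  rw [walksZd_succ, Set.ncard_iUnion_of_finite fun s => (walksZd_finite d n _).image _]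
  · simp_rw [Set.ncard_image_of_injective _ (snoc_left_injective v)]
    rw [finsum_eq_sum_of_fintype, Fintype.sum_prod_type]
    refine Finset.sum_congr rfl fun j _ => ?_
    simp [latticeStep, Pi.single_neg]
  · intro s t hst
    refine Set.disjoint_left.mpr ?_
    rintro _ ⟨w, hw, rfl⟩ ⟨w', hw', h⟩
    obtain rfl := snoc_left_injective v h
    exact hst (latticeStep_injective (sub_right_injective (hw.2.1.symm.trans hw'.2.1)))

lemma ncard_walksZd_le (d n : ℕ) (v : Fin d → ℤ) :
    (walksZd d n v).ncard ≤ (2 * d) ^ n := by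
  induction n generalizing v with
  | zero => rw [ncard_walksZd_zero]; split_ifs <;> simp
  | succ n ih =>
    rw [ncard_walksZd_succ]
    refine (Finset.sum_le_sum fun j _ => add_le_add (ih _) (ih _)).trans_eq ?_
    simp
    ring

/-- The number of nearest-neighbour walks of length `n` on `ℤ` from `0` to `m`. -/
def intWalkCount : ℕ → ℤ → ℕ
  | 0, m => if m = 0 then 1 else 0
  | n + 1, m => intWalkCount n (m - 1) + intWalkCount n (m + 1)

lemma intWalkCount_eq_zero_of_lt (n : ℕ) (m : ℤ) (h : n < m) : intWalkCount n m = 0 := by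
  induction n generalizing m with
  | zero => simp only [intWalkCount]; rw [if_neg]; lia
  | succ n ih => rw [intWalkCount, ih _ (by lia), ih _ (by lia)]

lemma intWalkCount_eq_zero_of_odd (n : ℕ) (m : ℤ) (h : Odd (n + m)) : intWalkCount n m = 0 := by
  induction n generalizing m with
  | zero => simp only [intWalkCount]; rw [if_neg]; rintro rfl; simp at h
  | succ n ih => rw [intWalkCount, ih _ (by grind), ih _ (by grind)]

lemma intWalkCount_eq_choose (n j : ℕ) : intWalkCount n (n - 2 * j) = n.choose j := by
  induction n generalizing j with
  | zero => cases j <;> simp [intWalkCount]; lia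
  | succ n ih =>
    cases j with
    | zero =>
      have h := ih 0
      rw [intWalkCount, intWalkCount_eq_zero_of_lt n (_ + 1) (by push_cast; lia)]
      simpa using h
    | succ j =>
      rw [intWalkCount, Nat.choose_succ_succ, ← ih j, ← ih (j + 1), add_comm]
      congr 2 <;> push_cast <;> ring

/-- The exponential generating function of the walks on `ℤ` from `0` to `m`. -/
noncomputable def intWalkSeries (m : ℤ) : PowerSeries ℝ :=
  PowerSeries.mk fun n => (intWalkCount n m : ℝ) / n.factorial

lemma derivative_intWalkSeries (m : ℤ) :
    PowerSeries.derivative ℝ (intWalkSeries m) = intWalkSeries (m - 1) + intWalkSeries (m + 1) := by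
  ext n
  have : (n.factorial : ℝ) ≠ 0 := by positivity
  have : (n + 1 : ℝ) ≠ 0 := by positivity
  simp only [PowerSeries.coeff_derivative, intWalkSeries, PowerSeries.coeff_mk, map_add,
    intWalkCount, Nat.factorial_succ]
  push_cast
  field_simp

lemma Derivation.map_finset_prod {R A ι : Type*} [CommSemiring R] [CommSemiring A] [Algebra R A]
    [DecidableEq ι] (D : Derivation R A A) (s : Finset ι) (f : ι → A) :
    D (∏ i ∈ s, f i) = ∑ i ∈ s, (∏ j ∈ s.erase i, f j) * D (f i) := by
  induction s using Finset.induction_on with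
  | empty => simp
  | insert a s ha ih =>
    rw [Finset.prod_insert ha, Finset.sum_insert ha, D.leibniz, ih, Finset.erase_insert ha,
      add_comm, smul_eq_mul, smul_eq_mul, Finset.mul_sum]
    congr 1
    refine Finset.sum_congr rfl fun i hi => ?_
    have hia : a ≠ i := fun h => ha (h ▸ hi)
    rw [Finset.erase_insert_of_ne hia, Finset.prod_insert (by simp [ha]), mul_assoc]

lemma prod_intWalkSeries_add_single {d : ℕ} (v : Fin d → ℤ) (j : Fin d) (c : ℤ) :
    ∏ i, intWalkSeries ((v + Pi.single j c : Fin d → ℤ) i) =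
      (∏ i ∈ Finset.univ.erase j, intWalkSeries (v i)) * intWalkSeries (v j + c) := by
  rw [← Finset.prod_erase_mul _ _ (Finset.mem_univ j)]
  congr 1
  · refine Finset.prod_congr rfl fun i hi => ?_
    simp [Finset.ne_of_mem_erase hi]
  · simp

lemma ncard_walksZd_eq_coeff (d n : ℕ) (v : Fin d → ℤ) :
    ((walksZd d n v).ncard : ℝ) =
      n.factorial * PowerSeries.coeff n (∏ j, intWalkSeries (v j)) := by
  induction n generalizing v with
  | zero =>
    simp only [ncard_walksZd_zero, PowerSeries.coeff_zero_eq_constantCoeff, map_prod]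
    simp only [← PowerSeries.coeff_zero_eq_constantCoeff_apply, intWalkSeries,
      PowerSeries.coeff_mk, intWalkCount]
    simp [funext_iff, Finset.prod_ite_zero]
  | succ n ih =>
    have hD : PowerSeries.derivative ℝ (∏ j, intWalkSeries (v j)) =
        ∑ j, (∏ i, intWalkSeries ((v - Pi.single j 1 : Fin d → ℤ) i) +
          ∏ i, intWalkSeries ((v + Pi.single j 1 : Fin d → ℤ) i)) := by
      rw [Derivation.map_finset_prod]
      refine Finset.sum_congr rfl fun j _ => ?_
      rw [sub_eq_add_neg, ← Pi.single_neg, prod_intWalkSeries_add_single,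
        prod_intWalkSeries_add_single, derivative_intWalkSeries, mul_add, sub_eq_add_neg]
    have hc := PowerSeries.coeff_derivative (∏ j, intWalkSeries (v j)) n
    rw [hD, map_sum] at hc
    rw [ncard_walksZd_succ, Nat.factorial_succ]
    push_cast
    simp_rw [ih]
    rw [mul_comm ((n : ℝ) + 1), mul_assoc, mul_comm ((n : ℝ) + 1), ← hc, Finset.mul_sum]
    simp [mul_add]

lemma hasSum_besselI0 (x : ℝ) :
    HasSum (fun k : ℕ => x ^ (2 * k) / (k.factorial : ℝ) ^ 2) (besselI0 (2 * x)) := by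
  have hs : Summable fun k : ℕ => x ^ (2 * k) / (k.factorial : ℝ) ^ 2 := by
    refine Summable.of_nonneg_of_le (fun k => ?_) (fun k => ?_)
      (Real.summable_pow_div_factorial (x ^ 2))
    · rw [pow_mul]; positivity
    · rw [pow_mul]
      have h1 : (1 : ℝ) ≤ k.factorial := by exact_mod_cast k.factorial_pos
      gcongr
      nlinarith
  simpa [besselI0] using hs.hasSum

lemma hasSum_intWalkSeries_zero (x : ℝ) :
    HasSum (fun n => PowerSeries.coeff n (intWalkSeries 0) * x ^ n) (besselI0 (2 * x)) := by
  have hinj : Function.Injective fun k : ℕ => 2 * k := fun a b h => by simpa using h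
  rw [← hinj.hasSum_iff]
  · convert hasSum_besselI0 x using 2 with k
    have h := intWalkCount_eq_choose (2 * k) k
    have hc := Nat.choose_mul_factorial_mul_factorial (n := 2 * k) (k := k) (by lia)
    rw [show 2 * k - k = k by lia] at hc
    have hc' : ((2 * k).choose k : ℝ) * k.factorial * k.factorial = (2 * k).factorial := by
      exact_mod_cast hc
    have : (k.factorial : ℝ) ≠ 0 := by positivity
    have : ((2 * k).choose k : ℝ) ≠ 0 := by
      exact_mod_cast (Nat.choose_pos (by lia : k ≤ 2 * k)).ne'
    push_cast at h
    rw [sub_self] at h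
    simp only [Function.comp_apply, intWalkSeries, PowerSeries.coeff_mk, h, ← hc']
    field_simp
  · intro n hn
    rw [intWalkSeries, PowerSeries.coeff_mk, intWalkCount_eq_zero_of_odd]
    · simp
    · have : Odd n := by
        rw [← Nat.not_even_iff_odd]
        rintro ⟨k, rfl⟩
        exact hn ⟨k, by simp; ring⟩
      simpa using this

lemma hasSum_coeff_pow {f : PowerSeries ℝ} {x a : ℝ}
    (hf : HasSum (fun n => PowerSeries.coeff n f * x ^ n) a) (d : ℕ) :
    HasSum (fun n => PowerSeries.coeff n (f ^ d) * x ^ n) (a ^ d) := by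
  induction d with
  | zero =>
    convert hasSum_ite_eq (0 : ℕ) (1 : ℝ) using 2 with n
    · rw [pow_zero, PowerSeries.coeff_one]
      split_ifs with h <;> simp [h]
    · simp
  | succ d ih =>
    have hterm (n : ℕ) : PowerSeries.coeff n (f ^ (d + 1)) * x ^ n =
        ∑ kl ∈ Finset.HasAntidiagonal.antidiagonal n,
          PowerSeries.coeff kl.1 (f ^ d) * x ^ kl.1 * (PowerSeries.coeff kl.2 f * x ^ kl.2) := by
      rw [pow_succ, PowerSeries.coeff_mul, Finset.sum_mul]
      refine Finset.sum_congr rfl fun kl hkl => ?_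
      rw [← Finset.HasAntidiagonal.mem_antidiagonal.mp hkl, pow_add]
      ring
    simp_rw [hterm, pow_succ]
    rw [← ih.tsum_eq, ← hf.tsum_eq,
      tsum_mul_tsum_eq_tsum_sum_antidiagonal_of_summable_norm ih.summable.norm hf.summable.norm]
    exact (summable_norm_sum_mul_antidiagonal_of_summable_norm ih.summable.norm
      hf.summable.norm).of_norm.hasSum

lemma hasSum_loopZd (d : ℕ) (x : ℝ) :
    HasSum (fun n => (loopZd d n).ncard * x ^ n / n.factorial) (besselI0 (2 * x) ^ d) := by
  convert hasSum_coeff_pow (hasSum_intWalkSeries_zero x) d using 2 with n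
  have h := ncard_walksZd_eq_coeff d n 0
  have : (n.factorial : ℝ) ≠ 0 := by positivity
  change ((loopZd d n).ncard : ℝ) = _ at h
  rw [h]
  simp
  field_simp

lemma returnProb_nonneg (d n : ℕ) : 0 ≤ returnProb d n := by
  unfold returnProb; positivity

lemma returnProb_le_one (d n : ℕ) : returnProb d n ≤ 1 :=
  div_le_one_of_le₀ (by exact_mod_cast ncard_walksZd_le d n 0) (by positivity)

lemma integrableOn_pow_mul_exp_neg (n : ℕ) :
    IntegrableOn (fun t : ℝ => t ^ n * Real.exp (-t)) (Set.Ioi 0) := by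
  have h := Real.GammaIntegral_convergent (s := n + 1) (by positivity)
  simpa [mul_comm] using h

lemma integral_pow_mul_exp_neg (n : ℕ) :
    ∫ t in Set.Ioi (0 : ℝ), t ^ n * Real.exp (-t) = n.factorial := by
  rw [← Real.Gamma_nat_eq_factorial, Real.Gamma_eq_integral (by positivity)]
  simp [mul_comm]

theorem return_gf_integral_rep (d : ℕ) (hd : 1 ≤ d) (z : ℝ) (hz0 : 0 ≤ z) (hz1 : z < 1) :
    (∑' n : ℕ, returnProb d n * z ^ n)
      = ∫ t in Set.Ioi (0:ℝ), (besselI0 (t * z / d)) ^ d * Real.exp (-t) := by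
  set F : ℕ → ℝ → ℝ := fun n t =>
    returnProb d n * z ^ n / n.factorial * (t ^ n * Real.exp (-t)) with hF
  have hint (n : ℕ) : IntegrableOn (F n) (Set.Ioi 0) :=
    (integrableOn_pow_mul_exp_neg n).const_mul _
  have hval (n : ℕ) : ∫ t in Set.Ioi (0 : ℝ), F n t = returnProb d n * z ^ n := by
    rw [hF, integral_const_mul, integral_pow_mul_exp_neg]
    field_simp
  have hnorm (n : ℕ) : ∫ t in Set.Ioi (0 : ℝ), ‖F n t‖ = returnProb d n * z ^ n := by
    rw [← hval]
    refine setIntegral_congr_fun measurableSet_Ioi fun t ht => ?_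
    have : 0 < t := ht
    have := returnProb_nonneg d n
    exact Real.norm_of_nonneg (by positivity)
  have hsum : Summable fun n => returnProb d n * z ^ n :=
    Summable.of_nonneg_of_le
      (fun n => mul_nonneg (returnProb_nonneg d n) (pow_nonneg hz0 n))
      (fun n => mul_le_of_le_one_left (pow_nonneg hz0 n) (returnProb_le_one d n))
      (summable_geometric_of_lt_one hz0 hz1)
  have key := hasSum_integral_of_summable_integral_norm hint (by simpa only [hnorm] using hsum)
  simp only [hval] at key
  rw [key.tsum_eq]
  refine integral_congr_ae (Filter.Eventually.of_forall fun t => ?_)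
  have hd0 : (d : ℝ) ≠ 0 := by positivity
  have h := (hasSum_loopZd d (t * z / (2 * d))).mul_right (Real.exp (-t))
  rw [show 2 * (t * z / (2 * d)) = t * z / d by field_simp] at h
  refine Eq.trans (tsum_congr fun n => ?_) h.tsum_eq
  simp only [hF, returnProb, div_pow, mul_pow]
  ring
end

section
/- lim_{z→1⁻} ∫_0^∞ I_0(tz/d)^d e^{−t} dt = +∞ if d ∈ {1, 2}, and this limit is finite if d ≥ 3. -/
open MeasureTheory Filter

theorem besselI0_term_eq (x : ℝ) (k : ℕ) :
    (x / 2) ^ (2 * k) / (k.factorial : ℝ) ^ 2 =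
      (k.centralBinom : ℝ) / 4 ^ k * (x ^ (2 * k) / (2 * k).factorial) := by
  have h : (k.centralBinom : ℝ) * ((k.factorial : ℝ) * k.factorial) = (2 * k).factorial := by
    have := Nat.choose_mul_factorial_mul_factorial (n := 2 * k) (k := k) (by omega)
    rw [show 2 * k - k = k by omega, mul_assoc] at this
    exact_mod_cast this
  have h0 : (k.centralBinom : ℝ) ≠ 0 := by exact_mod_cast k.centralBinom_ne_zero
  rw [← h, div_pow, pow_mul 2 2 k]
  norm_num
  field_simp

theorem centralBinom_div_four_pow_succ (k : ℕ) :
    ((k + 1).centralBinom : ℝ) / 4 ^ (k + 1) =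
      (k.centralBinom : ℝ) / 4 ^ k * ((2 * k + 1) / (2 * k + 2)) := by
  have h : ((k : ℝ) + 1) * (k + 1).centralBinom = 2 * (2 * k + 1) * k.centralBinom := by
    exact_mod_cast Nat.succ_mul_centralBinom_succ k
  have h0 : (k : ℝ) + 1 ≠ 0 := by positivity
  rw [show (2 * (k : ℝ) + 2) = 2 * (k + 1) by ring]
  field_simp
  rw [pow_succ]
  linear_combination 2 * h * 4 ^ k

theorem centralBinom_sq_mul_le (k : ℕ) :
    ((k.centralBinom : ℝ) / 4 ^ k) ^ 2 * (2 * k + 1) ≤ 1 := by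
  induction k with
  | zero => simp
  | succ k ih =>
    rw [centralBinom_div_four_pow_succ]
    refine le_trans ?_ ih
    rw [mul_pow, mul_assoc]
    gcongr
    push_cast
    rw [div_pow, div_mul_eq_mul_div, div_le_iff₀ (by positivity)]
    have : (0 : ℝ) ≤ k := k.cast_nonneg
    nlinarith

theorem one_le_centralBinom_sq_mul (k : ℕ) :
    1 ≤ ((k.centralBinom : ℝ) / 4 ^ k) ^ 2 * (4 * k + 1) := by
  induction k with
  | zero => simp
  | succ k ih =>
    rw [centralBinom_div_four_pow_succ]
    refine ih.trans ?_
    rw [mul_pow, mul_assoc]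
    gcongr
    push_cast
    rw [div_pow, div_mul_eq_mul_div, le_div_iff₀ (by positivity)]
    ring_nf
    linarith

theorem centralBinom_div_four_pow_le_one (k : ℕ) : (k.centralBinom : ℝ) / 4 ^ k ≤ 1 := by
  have h := centralBinom_sq_mul_le k
  have : (0 : ℝ) ≤ ((k.centralBinom : ℝ) / 4 ^ k) ^ 2 * k := by positivity
  rw [← sq_le_one_iff₀ (by positivity)]
  linarith

theorem summable_besselI0 (x : ℝ) :
    Summable fun k : ℕ => (x / 2) ^ (2 * k) / (k.factorial : ℝ) ^ 2 := by
  refine Summable.of_nonneg_of_le (fun k => ?_) (fun k => ?_) (Real.hasSum_cosh x).summable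
  · rw [pow_mul]; positivity
  · rw [besselI0_term_eq]
    exact mul_le_of_le_one_left (by rw [pow_mul]; positivity) (centralBinom_div_four_pow_le_one k)

theorem besselI0_le_exp {x : ℝ} (hx : 0 ≤ x) : besselI0 x ≤ Real.exp x := by
  have h : besselI0 x ≤ Real.cosh x := by
    rw [(Real.hasSum_cosh x).tsum_eq.symm]
    refine (summable_besselI0 x).tsum_le_tsum (fun k => ?_) (Real.hasSum_cosh x).summable
    rw [besselI0_term_eq]
    exact mul_le_of_le_one_left (by rw [pow_mul]; positivity) (centralBinom_div_four_pow_le_one k)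
  have := Real.cosh_add_sinh x
  have := Real.sinh_nonneg_iff.2 hx
  linarith

theorem besselI0_nonneg (x : ℝ) : 0 ≤ besselI0 x :=
  tsum_nonneg fun k => by rw [pow_mul]; positivity

theorem besselI0_le_besselI0 {x y : ℝ} (hx : 0 ≤ x) (hxy : x ≤ y) :
    besselI0 x ≤ besselI0 y :=
  (summable_besselI0 x).tsum_le_tsum (fun k => by gcongr) (summable_besselI0 y)

theorem continuous_besselI0 : Continuous besselI0 := by
  have h (R : ℝ) : ContinuousOn besselI0 (Set.Ioo (-R) R) := by
    refine continuousOn_tsum (fun k => by fun_prop) (summable_besselI0 R) fun k x hx => ?_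
    rw [Real.norm_eq_abs, abs_div, abs_pow, abs_div, abs_two, abs_of_nonneg
      (by positivity : (0 : ℝ) ≤ (k.factorial : ℝ) ^ 2)]
    have := (abs_lt.2 hx).le
    gcongr
  refine continuous_iff_continuousAt.2 fun x => (h (|x| + 1)).continuousAt ?_
  exact Ioo_mem_nhds (by linarith [neg_abs_le x]) (by linarith [le_abs_self x])

theorem besselI0_le_exp_div_sqrt {x : ℝ} (hx : 0 < x) :
    besselI0 x ≤ Real.exp x / (2 * √x) := by
  have hs : 0 < √x := Real.sqrt_pos.2 hx
  have hsx : √x ^ 2 = x := Real.sq_sqrt hx.le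
  have H := ((Real.hasSum_cosh x).mul_left (1 / (2 * √x))).add
    ((Real.hasSum_sinh x).mul_left (1 / (2 * √x)))
  rw [← mul_add, Real.cosh_add_sinh, one_div_mul_eq_div] at H
  rw [← H.tsum_eq]
  refine (summable_besselI0 x).tsum_le_tsum (fun k => ?_) H.summable
  rw [besselI0_term_eq]
  have hw := centralBinom_sq_mul_le k
  set w : ℝ := (k.centralBinom : ℝ) / 4 ^ k
  have hm : (0 : ℝ) < 2 * k + 1 := by positivity
  have key : w ≤ 1 / (2 * √x) * (1 + x / (2 * k + 1)) := by
    have h1 : w ^ 2 ≤ 1 / (2 * k + 1) := by rwa [le_div_iff₀ hm]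
    have h2 : 1 + x * w ^ 2 ≤ 1 + x / (2 * k + 1) := by
      rw [div_eq_mul_one_div]; gcongr
    rw [one_div_mul_eq_div, le_div_iff₀ (by positivity)]
    refine le_trans ?_ h2
    rw [← hsx, Real.sqrt_sq hs.le]
    nlinarith [sq_nonneg (√x * w - 1)]
  calc w * (x ^ (2 * k) / (2 * k).factorial)
      ≤ 1 / (2 * √x) * (1 + x / (2 * k + 1)) * (x ^ (2 * k) / (2 * k).factorial) := by gcongr
    _ = _ := by
      rw [Nat.factorial_succ, pow_succ]
      push_cast
      field_simp

theorem exp_div_sqrt_le_besselI0 {x : ℝ} (hx : 0 ≤ x) :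
    Real.exp x / (2 * √(2 * x + 1)) ≤ besselI0 x := by
  have hm : (0 : ℝ) < 2 * x + 1 := by positivity
  have hs : 0 < √(2 * x + 1) := Real.sqrt_pos.2 hm
  have hsx : √(2 * x + 1) ^ 2 = 2 * x + 1 := Real.sq_sqrt hm.le
  set s := √(2 * x + 1)
  have hsum : HasSum (fun k : ℕ => (2 * k : ℝ) * (x ^ (2 * k) / (2 * k).factorial))
      (x * Real.sinh x) := by
    rw [← hasSum_nat_add_iff' 1]
    have := (Real.hasSum_sinh x).mul_left x
    simp only [Finset.range_one, Finset.sum_singleton, Nat.cast_zero, mul_zero, zero_mul, sub_zero]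
    refine this.congr_fun fun k => ?_
    rw [show 2 * (k + 1) = 2 * k + 1 + 1 by ring, Nat.factorial_succ (2 * k + 1), pow_succ]
    push_cast
    field_simp
    ring
  have H := ((Real.hasSum_cosh x).mul_left (1 / (2 * s) * (3 - 1 / s ^ 2))).sub
    (hsum.mul_left (1 / s ^ 3))
  have hle := H.summable.tsum_le_tsum (fun k => ?_) (summable_besselI0 x)
  · rw [H.tsum_eq] at hle
    refine le_trans ?_ hle
    have h1 := Real.cosh_add_sinh x
    have h2 := Real.sinh_nonneg_iff.2 hx
    have h3 := Real.sinh_lt_cosh x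
    have h4 : (1 / (2 * s) * (3 - 1 / s ^ 2)) * Real.cosh x - 1 / s ^ 3 * (x * Real.sinh x) =
        (2 * Real.cosh x + 2 * x * (Real.cosh x - Real.sinh x) / s ^ 2) / (2 * s) := by
      rw [show 1 / s ^ 3 * (x * Real.sinh x) = (2 * x * Real.sinh x / s ^ 2) / (2 * s) by
        field_simp]
      have : 1 / s ^ 2 = 1 - 2 * x / s ^ 2 := by
        field_simp; linarith
      rw [this]
      field_simp
      ring
    rw [h4]
    have h5 : 0 ≤ 2 * x * (Real.cosh x - Real.sinh x) / s ^ 2 := by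
      have : 0 ≤ Real.cosh x - Real.sinh x := by linarith
      positivity
    gcongr
    linarith
  · rw [besselI0_term_eq]
    have hw := one_le_centralBinom_sq_mul k
    have hw0 : 0 ≤ (k.centralBinom : ℝ) / 4 ^ k := by positivity
    set w : ℝ := (k.centralBinom : ℝ) / 4 ^ k
    have key : 1 / (2 * s) * (3 - (4 * k + 1) / s ^ 2) ≤ w := by
      set q := √(4 * (k : ℝ) + 1)
      have hq : q ^ 2 = 4 * k + 1 := Real.sq_sqrt (by positivity)
      have hq0 : 0 < q := Real.sqrt_pos.2 (by positivity)
      have hwq : 1 / q ≤ w := by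
        rw [div_le_iff₀ hq0, ← one_le_sq_iff₀ (by positivity), mul_pow, hq]
        exact hw
      refine le_trans ?_ hwq
      rw [← hq, le_div_iff₀ hq0]
      have : 0 ≤ (q - s) ^ 2 * (q + 2 * s) / (2 * s ^ 3) := by positivity
      have e : 1 / (2 * s) * (3 - q ^ 2 / s ^ 2) * q =
          1 - (q - s) ^ 2 * (q + 2 * s) / (2 * s ^ 3) := by
        field_simp
        ring
      linarith
    have hp : 0 ≤ x ^ (2 * k) / ((2 * k).factorial : ℝ) := by positivity
    refine le_trans (le_of_eq ?_) (mul_le_mul_of_nonneg_right key hp)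
    field_simp
    ring

theorem continuous_besselI0_integrand (d : ℕ) (z : ℝ) :
    Continuous fun t : ℝ => besselI0 (t * z / d) ^ d * Real.exp (-t) := by
  have := continuous_besselI0
  fun_prop

theorem besselI0_integrand_nonneg (d : ℕ) (z t : ℝ) :
    0 ≤ besselI0 (t * z / d) ^ d * Real.exp (-t) :=
  mul_nonneg (pow_nonneg (besselI0_nonneg _) _) (Real.exp_pos _).le

theorem integrableOn_besselI0_integrand {d : ℕ} (hd : d ≠ 0) {z : ℝ} (hz : 0 ≤ z) (hz1 : z < 1) :
    IntegrableOn (fun t : ℝ => besselI0 (t * z / d) ^ d * Real.exp (-t)) (Set.Ioi 0) := by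
  refine (integrableOn_exp_mul_Ioi (a := z - 1) (by linarith) 0).mono'
    (continuous_besselI0_integrand d z).aestronglyMeasurable ?_
  refine (ae_restrict_iff' measurableSet_Ioi).2 (ae_of_all _ fun t (ht : 0 < t) => ?_)
  rw [Real.norm_of_nonneg (besselI0_integrand_nonneg d z t)]
  calc besselI0 (t * z / d) ^ d * Real.exp (-t)
      ≤ Real.exp (t * z / d) ^ d * Real.exp (-t) := by
        gcongr
        · exact besselI0_nonneg _
        · exact besselI0_le_exp (by positivity)
    _ = Real.exp ((z - 1) * t) := by
        rw [← Real.exp_nat_mul, ← Real.exp_add]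
        congr 1
        field_simp
        ring

theorem integrableOn_besselI0_integrand_one {d : ℕ} (hd : 3 ≤ d) :
    IntegrableOn (fun t : ℝ => besselI0 (t * 1 / d) ^ d * Real.exp (-t)) (Set.Ioi 0) := by
  have hd0 : (0 : ℝ) < d := by exact_mod_cast (by omega : 0 < d)
  have hcont := continuous_besselI0_integrand d 1
  rw [← Set.Ioc_union_Ioi_eq_Ioi zero_le_one]
  refine (hcont.integrableOn_Ioc).union ?_
  refine ((integrableOn_Ioi_rpow_of_lt (a := -(3 / 2)) (by norm_num) one_pos).const_mul
    ((√d / 2) ^ 3)).mono' hcont.aestronglyMeasurable ?_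
  refine (ae_restrict_iff' measurableSet_Ioi).2 (ae_of_all _ fun t (ht : 1 < t) => ?_)
  have ht0 : 0 < t := by linarith
  rw [Real.norm_of_nonneg (besselI0_integrand_nonneg d 1 t), mul_one]
  set x := t / d with hx
  have hx0 : 0 < x := by positivity
  have hexp : Real.exp (-t) = Real.exp (-x) ^ d := by
    rw [← Real.exp_nat_mul, hx]
    congr 1
    field_simp
  have hnn : 0 ≤ besselI0 x * Real.exp (-x) := mul_nonneg (besselI0_nonneg _) (Real.exp_pos _).le
  rw [hexp, ← mul_pow]
  calc (besselI0 x * Real.exp (-x)) ^ d ≤ (besselI0 x * Real.exp (-x)) ^ 3 := by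
        refine pow_le_pow_of_le_one hnn ?_ hd
        rw [Real.exp_neg, ← div_eq_mul_inv, div_le_one (Real.exp_pos _)]
        exact besselI0_le_exp hx0.le
    _ ≤ (√d / 2 * t ^ (-(1 / 2) : ℝ)) ^ 3 := by
        refine pow_le_pow_left₀ hnn ?_ 3
        rw [Real.exp_neg, ← div_eq_mul_inv, div_le_iff₀ (Real.exp_pos _)]
        refine (besselI0_le_exp_div_sqrt hx0).trans (le_of_eq ?_)
        rw [hx, Real.sqrt_div ht0.le, Real.rpow_neg ht0.le, ← Real.sqrt_eq_rpow]
        field_simp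
    _ = (√d / 2) ^ 3 * t ^ (-(3 / 2) : ℝ) := by
        rw [mul_pow, ← Real.rpow_natCast (t ^ _), ← Real.rpow_mul ht0.le]
        norm_num

theorem exp_div_le_besselI0_pow {d : ℕ} (hd : d = 1 ∨ d = 2) {y : ℝ} (hy : 0 ≤ y) :
    Real.exp y / (4 * (2 * y + 1)) ≤ besselI0 (y / d) ^ d := by
  rcases hd with rfl | rfl
  · simp only [Nat.cast_one, div_one, pow_one]
    refine le_trans ?_ (exp_div_sqrt_le_besselI0 hy)
    have h1 : √(2 * y + 1) ≤ 2 * y + 1 := Real.sqrt_le_iff.2 ⟨by linarith, by nlinarith⟩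
    have h2 : 0 < √(2 * y + 1) := Real.sqrt_pos.2 (by linarith)
    gcongr
    norm_num
  · have h := exp_div_sqrt_le_besselI0 (x := y / 2) (by positivity)
    calc Real.exp y / (4 * (2 * y + 1)) ≤ Real.exp y / (4 * (y + 1)) := by gcongr; linarith
      _ = (Real.exp (y / 2) / (2 * √(2 * (y / 2) + 1))) ^ 2 := by
        rw [div_pow, mul_pow, Real.sq_sqrt (by positivity), ← Real.exp_nat_mul]
        norm_num
        ring_nf
      _ ≤ _ := by push_cast; gcongr

theorem log_le_integral_besselI0 {d : ℕ} (hd : d = 1 ∨ d = 2) {z : ℝ} (hz : 0 ≤ z) (hz1 : z < 1) :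
    Real.exp (-1) / 8 * Real.log (1 + (1 - z)⁻¹) ≤
      ∫ t in Set.Ioi (0 : ℝ), besselI0 (t * z / d) ^ d * Real.exp (-t) := by
  have hz2 : 0 < 1 - z := by linarith
  have hT : 0 < (1 - z)⁻¹ := by positivity
  set T := (1 - z)⁻¹ with hTdef
  have hint := integrableOn_besselI0_integrand (d := d) (by omega) hz hz1
  have hlog : ∫ t in (0 : ℝ)..T, (t + 1)⁻¹ = Real.log (1 + T) := by
    rw [intervalIntegral.integral_comp_add_right (fun t => t⁻¹), zero_add,
      integral_inv_of_pos one_pos (by linarith), div_one, add_comm]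
  rw [← hlog, ← intervalIntegral.integral_const_mul, intervalIntegral.integral_of_le hT.le]
  have hsub : Set.Ioc 0 T ⊆ Set.Ioi (0 : ℝ) := Set.Ioc_subset_Ioi_self
  refine le_trans ?_ (setIntegral_mono_set hint
    (ae_of_all _ fun t => besselI0_integrand_nonneg d z t) hsub.eventuallyLE)
  have hci : ContinuousOn (fun t : ℝ => Real.exp (-1) / 8 * (t + 1)⁻¹) (Set.Icc 0 T) := by
    refine continuousOn_const.mul (ContinuousOn.inv₀ (by fun_prop) fun t ht => ?_)
    linarith [ht.1]
  refine setIntegral_mono_on (hci.integrableOn_Icc.mono_set Set.Ioc_subset_Icc_self)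
    (hint.mono_set hsub) measurableSet_Ioc fun t ht => ?_
  have ht0 : 0 < t := ht.1
  have htz : t * (1 - z) ≤ 1 := by
    have := mul_le_mul_of_nonneg_right ht.2 hz2.le
    rwa [hTdef, inv_mul_cancel₀ hz2.ne'] at this
  have h1 : t * z ≤ t := mul_le_of_le_one_right ht0.le hz1.le
  calc Real.exp (-1) / 8 * (t + 1)⁻¹ = Real.exp (-1) / (4 * (2 * (t + 1))) := by
        field_simp; norm_num
    _ ≤ Real.exp (t * z - t) / (4 * (2 * (t * z) + 1)) := by
        gcongr
        · linarith
        · linarith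
    _ = Real.exp (t * z) / (4 * (2 * (t * z) + 1)) * Real.exp (-t) := by
        rw [sub_eq_add_neg, Real.exp_add]; ring
    _ ≤ _ := by
        gcongr
        exact exp_div_le_besselI0_pow hd (by positivity)

theorem bessel_integral_limit (d : ℕ) :
    ((d = 1 ∨ d = 2) →
      Tendsto
        (fun z : ℝ => ∫ t in Set.Ioi (0:ℝ), (besselI0 (t * z / d)) ^ d * Real.exp (-t))
        (nhdsWithin 1 (Set.Ico (0:ℝ) 1)) atTop) ∧
    (3 ≤ d →
      ∃ L : ℝ, Tendsto
        (fun z : ℝ => ∫ t in Set.Ioi (0:ℝ), (besselI0 (t * z / d)) ^ d * Real.exp (-t))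
        (nhdsWithin 1 (Set.Ico (0:ℝ) 1)) (nhds L)) := by
  refine ⟨fun hd => ?_, fun hd => ⟨_, tendsto_integral_filter_of_dominated_convergence
    (fun t => besselI0 (t * 1 / d) ^ d * Real.exp (-t)) ?_ ?_
    (integrableOn_besselI0_integrand_one hd)
    (f := fun t => besselI0 (t * 1 / d) ^ d * Real.exp (-t)) ?_⟩⟩
  · have hlim : Tendsto (fun z : ℝ => 1 - z) (nhdsWithin 1 (Set.Ico (0 : ℝ) 1))
        (nhdsWithin 0 (Set.Ioi 0)) := by
      refine tendsto_nhdsWithin_iff.2 ⟨?_, eventually_mem_nhdsWithin.mono fun z hz => ?_⟩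
      · have : Tendsto (fun z : ℝ => 1 - z) (nhds 1) (nhds (1 - 1)) :=
          (continuous_const.sub continuous_id).tendsto 1
        rw [sub_self] at this
        exact this.mono_left nhdsWithin_le_nhds
      · exact sub_pos.2 hz.2
    have hlog := (Real.tendsto_log_atTop.comp (tendsto_atTop_add_const_left _ 1
      (tendsto_inv_nhdsGT_zero.comp hlim))).const_mul_atTop
      (by positivity : 0 < Real.exp (-1) / 8)
    exact tendsto_atTop_mono' _ (eventually_mem_nhdsWithin.mono fun z hz =>
      log_le_integral_besselI0 hd hz.1 hz.2) hlog
  · exact Eventually.of_forall fun z => (continuous_besselI0_integrand d z).aestronglyMeasurable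
  · refine eventually_mem_nhdsWithin.mono fun z hz => ?_
    refine (ae_restrict_iff' measurableSet_Ioi).2 (ae_of_all _ fun t (ht : 0 < t) => ?_)
    rw [Real.norm_of_nonneg (besselI0_integrand_nonneg d z t)]
    have hz0 := hz.1
    gcongr
    · exact besselI0_nonneg _
    · refine besselI0_le_besselI0 (by positivity) ?_
      gcongr
      exact hz.2.le
  · refine ae_of_all _ fun t => ?_
    have hc : Continuous fun z : ℝ => besselI0 (t * z / d) ^ d * Real.exp (-t) := by
      have := continuous_besselI0
      fun_prop
    exact (hc.tendsto 1).mono_left nhdsWithin_le_nhds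
end
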